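/- Let f : R^d → R be convex with L-Lipschitz gradient and minimizer x_*. Fix N ≥ 1 and let x_0,...,x_N be generated by OGM1: y_{i+1} = x_i - (1/L) f'(x_i); θ_0 = 1, θ_{i+1} = (1+sqrt(1+4θ_i^2))/2 for i ≤ N-2, θ_N = (1+sqrt(1+8θ_{N-1}^2))/2; x_{i+1} = y_{i+1} + ((θ_i - 1)/θ_{i+1})(y_{i+1} - y_i) + (θ_i/θ_{i+1})(y_{i+1} - x_i). Then f(x_N) - f(x_*) ≤ L||x_0 - x_*||^2/(2θ_N^2) ≤ L||x_0 - x_*||^2/((N+1)(N+1+sqrt(2))). -/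

import Mathlib

noncomputable def tseq : ℕ → ℝ
  | 0 => 1
  | i + 1 => (1 + Real.sqrt (1 + 4 * (tseq i) ^ 2)) / 2

noncomputable def θseq (N i : ℕ) : ℝ :=
  if i < N then tseq i else (1 + Real.sqrt (1 + 8 * (tseq (N - 1)) ^ 2)) / 2

theorem aux_line {E : Type*} [NormedAddCommGroup E] [InnerProductSpace ℝ E] [CompleteSpace E]
    (f : E → ℝ) (f' : E → E) (hgrad : ∀ x, HasGradientAt f (f' x) x) (a v : E) (τ : ℝ) :
    HasDerivAt (fun τ : ℝ => f (a + τ • v)) (inner ℝ (f' (a + τ • v)) v) τ := by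
  have h1 : HasDerivAt (fun τ : ℝ => a + τ • v) v τ := by
    simpa using ((hasDerivAt_id τ).smul_const v).const_add a
  have h2 := (hgrad (a + τ • v)).hasFDerivAt.comp_hasDerivAt τ h1
  have h3 : HasDerivAt (fun τ : ℝ => f (a + τ • v))
      ((InnerProductSpace.toDual ℝ E) (f' (a + τ • v)) v) τ := h2
  rwa [InnerProductSpace.toDual_apply_apply] at h3

theorem aux_descent {E : Type*} [NormedAddCommGroup E] [InnerProductSpace ℝ E] [CompleteSpace E]
    (L : ℝ) (f : E → ℝ) (f' : E → E) (hgrad : ∀ x, HasGradientAt f (f' x) x)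
    (hlip : ∀ x y, ‖f' x - f' y‖ ≤ L * ‖x - y‖) (a v : E) :
    f (a + v) ≤ f a + inner ℝ (f' a) v + L / 2 * ‖v‖ ^ 2 := by
  have h := image_le_of_deriv_right_le_deriv_boundary (a := (0:ℝ)) (b := 1)
    (f := fun τ : ℝ => f (a + τ • v)) (f' := fun τ => inner ℝ (f' (a + τ • v)) v)
    (B := fun τ => f a + τ * inner ℝ (f' a) v + L / 2 * ‖v‖ ^ 2 * τ ^ 2)
    (B' := fun τ => inner ℝ (f' a) v + L * ‖v‖ ^ 2 * τ)
    (fun τ _ => (aux_line f f' hgrad a v τ).continuousAt.continuousWithinAt)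
    (fun τ _ => (aux_line f f' hgrad a v τ).hasDerivWithinAt)
    (by simp) (by fun_prop)
    (fun τ _ => by
      have h1 := ((((hasDerivAt_id τ).mul_const (inner ℝ (f' a) v)).const_add (f a)).add
        (((hasDerivAt_id τ).pow 2).const_mul (L / 2 * ‖v‖ ^ 2)))
      refine HasDerivAt.hasDerivWithinAt ?_
      refine h1.congr_deriv ?_
      simp
      ring)
    (fun τ hτ => by
      have h1 : inner ℝ (f' (a + τ • v) - f' a) v ≤ ‖f' (a + τ • v) - f' a‖ * ‖v‖ :=
        real_inner_le_norm _ _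
      have h2 := hlip (a + τ • v) a
      rw [add_sub_cancel_left, norm_smul, Real.norm_of_nonneg hτ.1] at h2
      have h3 := mul_le_mul_of_nonneg_right h2 (norm_nonneg v)
      rw [inner_sub_left] at h1
      show inner ℝ (f' (a + τ • v)) v ≤ inner ℝ (f' a) v + L * ‖v‖ ^ 2 * τ
      nlinarith)
    (Set.right_mem_Icc.2 zero_le_one)
  simpa using h

theorem aux_convex {E : Type*} [NormedAddCommGroup E] [InnerProductSpace ℝ E] [CompleteSpace E]
    (f : E → ℝ) (f' : E → E) (hconv : ConvexOn ℝ Set.univ f)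
    (hgrad : ∀ x, HasGradientAt f (f' x) x) (a v : E) :
    f a + inner ℝ (f' a) v ≤ f (a + v) := by
  have hc : ConvexOn ℝ Set.univ (fun τ : ℝ => f (a + τ • v)) := by
    refine ⟨convex_univ, fun p _ q _ α β hα hβ hab => ?_⟩
    have := hconv.2 (Set.mem_univ (a + p • v)) (Set.mem_univ (a + q • v)) hα hβ hab
    convert this using 2
    have : β = 1 - α := by linarith
    subst this
    simp only [smul_eq_mul]
    module
  have hd := aux_line f f' hgrad a v 0
  have := hc.le_slope_of_hasDerivAt (Set.mem_univ 0) (Set.mem_univ 1) zero_lt_one hd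
  simp [slope_def_field] at this
  linarith

theorem aux_coco {E : Type*} [NormedAddCommGroup E] [InnerProductSpace ℝ E] [CompleteSpace E]
    (L : ℝ) (hL : 0 < L) (f : E → ℝ) (f' : E → E) (hconv : ConvexOn ℝ Set.univ f)
    (hgrad : ∀ x, HasGradientAt f (f' x) x)
    (hlip : ∀ x y, ‖f' x - f' y‖ ≤ L * ‖x - y‖) (a b : E) :
    f b + inner ℝ (f' b) (a - b) + 1 / (2 * L) * ‖f' a - f' b‖ ^ 2 ≤ f a := by
  have h1 := aux_descent L f f' hgrad hlip a (-(1 / L) • (f' a - f' b))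
  have h2 := aux_convex f f' hconv hgrad b (a + -(1 / L) • (f' a - f' b) - b)
  rw [add_sub_cancel] at h2
  have h3 : inner ℝ (f' a - f' b) (f' a - f' b) = ‖f' a - f' b‖ ^ 2 :=
    real_inner_self_eq_norm_sq _
  rw [norm_smul, mul_pow, Real.norm_eq_abs, sq_abs] at h1
  rw [add_sub_right_comm, inner_add_right, inner_smul_right] at h2
  rw [inner_smul_right] at h1
  have h4 : L / 2 * ((-(1 / L)) ^ 2 * ‖f' a - f' b‖ ^ 2) = 1 / (2 * L) * ‖f' a - f' b‖ ^ 2 := by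
    field_simp
  have h5 : 1 / L * ‖f' a - f' b‖ ^ 2 = 2 * (1 / (2 * L) * ‖f' a - f' b‖ ^ 2) := by
    field_simp
  rw [inner_sub_left] at h3
  rw [h4] at h1
  rw [← h3, mul_sub, h3] at h5
  linarith

/-- common one-step inequality; `c` is the step multiplier (`2` for inner steps, `1` for the last). -/
theorem aux_step {E : Type*} [NormedAddCommGroup E] [InnerProductSpace ℝ E]
    (L : ℝ) (hL : 0 < L) (X X' z xs g h : E) (F F' Fs t s c : ℝ) (hc : 0 ≤ c) (hs : 0 ≤ s)
    (hts : c * (s ^ 2 - s) = 2 * t ^ 2)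
    (hX : s • X' = (s - 1) • (X - (1 / L) • g) + z)
    (h1 : F' + inner ℝ h (X - X') + 1 / (2 * L) * ‖g - h‖ ^ 2 ≤ F)
    (h2 : F' + inner ℝ h (xs - X') + 1 / (2 * L) * ‖(0:E) - h‖ ^ 2 ≤ Fs) :
    c * s ^ 2 * (F' - Fs) - (c - 1) * c * s ^ 2 / (2 * L) * ‖h‖ ^ 2
      + L / 2 * ‖z - (c * s / L) • h - xs‖ ^ 2 ≤
    2 * t ^ 2 * (F - Fs - 1 / (2 * L) * ‖g‖ ^ 2) + L / 2 * ‖z - xs‖ ^ 2 := by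
  have hi := congrArg (fun w => inner ℝ h w) hX
  simp only [inner_add_right, inner_sub_right, inner_smul_right] at hi
  have e1 : ‖g - h‖ ^ 2 = ‖g‖ ^ 2 - 2 * inner ℝ h g + ‖h‖ ^ 2 := by
    rw [norm_sub_sq_real, real_inner_comm]
  have e2 : ‖z - (c * s / L) • h - xs‖ ^ 2 = ‖z - xs‖ ^ 2
      - 2 * (c * s / L) * (inner ℝ h z - inner ℝ h xs) + (c * s / L) ^ 2 * ‖h‖ ^ 2 := by
    rw [sub_right_comm, norm_sub_sq_real, inner_smul_right, norm_smul, mul_pow,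
      Real.norm_eq_abs, sq_abs, real_inner_comm, inner_sub_right]
    ring
  rw [zero_sub, norm_neg] at h2
  rw [e1, inner_sub_right] at h1
  rw [inner_sub_right] at h2
  rw [e2]
  have k1 := mul_le_mul_of_nonneg_left h1 (by positivity : 0 ≤ 2 * t ^ 2)
  have k2 := mul_le_mul_of_nonneg_left h2 (by positivity : 0 ≤ c * s)
  rw [← hts] at k1 ⊢
  obtain ⟨M, hM⟩ : ∃ M, M = 1 / L := ⟨_, rfl⟩
  have hLM : L * M = 1 := by rw [hM]; field_simp
  have q1 : 1 / (2 * L) = M / 2 := by rw [hM]; field_simp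
  have q2 : c * s / L = c * s * M := by rw [hM]; field_simp
  have q3 : (c - 1) * c * s ^ 2 / (2 * L) = (c - 1) * c * s ^ 2 * M / 2 := by rw [hM]; field_simp
  rw [q1] at k1 k2 ⊢
  rw [q2, q3]
  rw [← hM] at hi
  generalize (inner ℝ h z : ℝ) = hz at *
  generalize (inner ℝ h xs : ℝ) = hxs at *
  generalize (inner ℝ h g : ℝ) = hg at *
  generalize (inner ℝ h X : ℝ) = hX0 at *
  generalize (inner ℝ h X' : ℝ) = hX1 at *
  generalize ‖h‖ ^ 2 = nh at *
  generalize ‖g‖ ^ 2 = ng at *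
  generalize ‖z - xs‖ ^ 2 = nz at *
  linear_combination k1 + k2 + c * s * hi + (- c * s * (hz - hxs) + c ^ 2 * s ^ 2 * M / 2 * nh) * hLM

theorem tseq_ge (i : ℕ) : ((i : ℝ) + 2) / 2 ≤ tseq i := by
  induction i with
  | zero => simp [tseq]
  | succ k ih =>
    have : (k : ℝ) + 2 ≤ Real.sqrt (1 + 4 * (tseq k) ^ 2) := by
      apply Real.le_sqrt_of_sq_le
      have : (0:ℝ) ≤ k := Nat.cast_nonneg k
      nlinarith
    simp only [tseq]
    push_cast
    linarith

theorem tseq_succ (i : ℕ) : tseq (i + 1) ^ 2 - tseq (i + 1) = tseq i ^ 2 := by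
  have := Real.sq_sqrt (by positivity : 0 ≤ 1 + 4 * (tseq i) ^ 2)
  simp only [tseq]
  linear_combination this / 4

/-- Convergence bound for the optimized gradient method OGM1 of Kim and Fessler. -/
theorem stmt_16 (d N : ℕ) (hN : 1 ≤ N) (L : ℝ) (hL : 0 < L)
    (f : EuclideanSpace ℝ (Fin d) → ℝ)
    (f' : EuclideanSpace ℝ (Fin d) → EuclideanSpace ℝ (Fin d))
    (hconv : ConvexOn ℝ Set.univ f)
    (hgrad : ∀ x, HasGradientAt f (f' x) x)
    (hlip : ∀ x y, ‖f' x - f' y‖ ≤ L * ‖x - y‖)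
    (xstar : EuclideanSpace ℝ (Fin d)) (hmin : ∀ z, f xstar ≤ f z)
    (x y : ℕ → EuclideanSpace ℝ (Fin d))
    (hy0 : y 0 = x 0)
    (hyrec : ∀ i : ℕ, i + 1 ≤ N → y (i + 1) = x i - (1 / L) • f' (x i))
    (hxrec : ∀ i : ℕ, i + 1 ≤ N → x (i + 1) =
      y (i + 1) + ((θseq N i - 1) / θseq N (i + 1)) • (y (i + 1) - y i)
        + (θseq N i / θseq N (i + 1)) • (y (i + 1) - x i)) :
    f (x N) - f xstar ≤ L * ‖x 0 - xstar‖ ^ 2 / (2 * (θseq N N) ^ 2) ∧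
    L * ‖x 0 - xstar‖ ^ 2 / (2 * (θseq N N) ^ 2) ≤
      L * ‖x 0 - xstar‖ ^ 2 / (((N : ℝ) + 1) * ((N : ℝ) + 1 + Real.sqrt 2)) := by
  obtain ⟨n, rfl⟩ : ∃ n, N = n + 1 := ⟨N - 1, by omega⟩
  obtain ⟨θ, hθ⟩ : ∃ θ, θ = θseq (n + 1) := ⟨_, rfl⟩
  have hθlt : ∀ i, i ≤ n → θ i = tseq i := fun i hi => by
    rw [hθ, θseq, if_pos (by omega)]
  have hθN : θ (n + 1) = (1 + Real.sqrt (1 + 8 * (tseq n) ^ 2)) / 2 := by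
    rw [hθ, θseq, if_neg (by omega)]; rfl
  have hθN2 : θ (n + 1) ^ 2 - θ (n + 1) = 2 * θ n ^ 2 := by
    have := Real.sq_sqrt (by positivity : 0 ≤ 1 + 8 * (tseq n) ^ 2)
    rw [hθN, hθlt n le_rfl]
    linear_combination this / 4
  have hθpos : ∀ i, i ≤ n + 1 → 0 < θ i := fun i hi => by
    rcases Nat.lt_or_ge n i with h | h
    · obtain rfl : i = n + 1 := by omega
      rw [hθN]; positivity
    · rw [hθlt i h]
      exact lt_of_lt_of_le (by positivity) (tseq_ge i)
  simp only [← hθ] at hxrec ⊢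
  constructor
  · obtain ⟨z, hz⟩ : ∃ z : ℕ → EuclideanSpace ℝ (Fin d),
        ∀ i, z i = θ i • x i - (θ i - 1) • y i := ⟨_, fun _ => rfl⟩
    have hz0 : z 0 = x 0 := by
      rw [hz, hy0, hθlt 0 (Nat.zero_le _), tseq]; module
    have hzs : ∀ i, i ≤ n → z (i + 1) = z i - (2 * θ i / L) • f' (x i) := fun i hi => by
      have hp := (hθpos (i + 1) (by omega)).ne'
      have h1 : θ (i + 1) • x (i + 1) = θ (i + 1) • y (i + 1) + (θ i - 1) • (y (i + 1) - y i)
          + θ i • (y (i + 1) - x i) := by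
        rw [hxrec i (by omega), smul_add, smul_add, smul_smul, smul_smul,
          mul_div_cancel₀ _ hp, mul_div_cancel₀ _ hp]
      rw [hz, h1, hz, hyrec i (by omega)]
      module
    have hX : ∀ i, i ≤ n → θ (i + 1) • x (i + 1) =
        (θ (i + 1) - 1) • (x i - (1 / L) • f' (x i)) + z (i + 1) := fun i hi => by
      rw [hz, hyrec i (by omega)]; module
    have hgs : f' xstar = 0 := by
      have hm : IsLocalMin f xstar := Filter.Eventually.of_forall hmin
      have := hm.hasFDerivAt_eq_zero (hgrad xstar).hasFDerivAt
      simpa using this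
    have hco := aux_coco L hL f f' hconv hgrad hlip
    have hcs : ∀ b, f b + inner ℝ (f' b) (xstar - b)
        + 1 / (2 * L) * ‖(0 : EuclideanSpace ℝ (Fin d)) - f' b‖ ^ 2 ≤ f xstar := fun b => by
      have := hco xstar b
      rwa [hgs] at this
    have hU : ∀ i, i ≤ n → 2 * θ i ^ 2 * (f (x i) - f xstar - 1 / (2 * L) * ‖f' (x i)‖ ^ 2)
        + L / 2 * ‖z (i + 1) - xstar‖ ^ 2 ≤ L / 2 * ‖x 0 - xstar‖ ^ 2 := by
      intro i
      induction i with
      | zero =>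
        intro h0
        have hs1 : θ 0 = 1 := by rw [hθlt 0 h0, tseq]
        have := aux_step L hL (x 0) (x 0) (x 0) xstar (f' (x 0)) (f' (x 0)) (f (x 0)) (f (x 0))
          (f xstar) 0 1 2 (by norm_num) (by norm_num) (by norm_num) (by module) (by simp)
          (hcs (x 0))
        rw [hzs 0 h0, hz0, hs1]
        convert this using 1 <;> ring_nf
      | succ k ih =>
        intro hk
        refine le_trans ?_ (ih (by omega))
        have h1 := tseq_succ k
        rw [← hθlt k (by omega), ← hθlt (k + 1) hk] at h1
        have := aux_step L hL (x k) (x (k + 1)) (z (k + 1)) xstar (f' (x k)) (f' (x (k + 1)))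
          (f (x k)) (f (x (k + 1))) (f xstar) (θ k) (θ (k + 1)) 2 (by norm_num)
          (hθpos _ (by omega)).le (by linarith) (hX k (by omega)) (hco _ _) (hcs _)
        rw [hzs (k + 1) hk]
        refine le_trans (le_of_eq ?_) this
        ring
    have hfin := aux_step L hL (x n) (x (n + 1)) (z (n + 1)) xstar (f' (x n)) (f' (x (n + 1)))
          (f (x n)) (f (x (n + 1))) (f xstar) (θ n) (θ (n + 1)) 1 (by norm_num)
          (hθpos _ (by omega)).le (by linarith) (hX n le_rfl) (hco _ _) (hcs _)
    have hUn := hU n le_rfl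
    have hp := hθpos (n + 1) le_rfl
    have hnn : 0 ≤ L / 2 * ‖z (n + 1) - (1 * θ (n + 1) / L) • f' (x (n + 1)) - xstar‖ ^ 2 := by
      positivity
    rw [le_div_iff₀ (by positivity)]
    simp only [sub_self, zero_mul, zero_div, one_mul] at hfin hnn
    linarith
  · have hr : Real.sqrt 2 * ((n : ℝ) + 2) ≤ Real.sqrt (1 + 8 * (tseq n) ^ 2) := by
      apply Real.le_sqrt_of_sq_le
      have h2 := Real.sq_sqrt (by norm_num : (0:ℝ) ≤ 2)
      have h3 := tseq_ge n
      have : (0:ℝ) ≤ n := Nat.cast_nonneg n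
      rw [mul_pow, h2]
      nlinarith
    have hge : (1 + Real.sqrt 2 * ((n : ℝ) + 2)) / 2 ≤ θ (n + 1) := by rw [hθN]; linarith
    have hsq := pow_le_pow_left₀ (by positivity) hge 2
    have h2 := Real.sq_sqrt (by norm_num : (0:ℝ) ≤ 2)
    apply div_le_div_of_nonneg_left (by positivity) (by positivity)
    push_cast
    nlinarith
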